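/- Let Ω ⊆ ℂⁿ be a bounded open set such that A^∞(Ω) is dense in A²(Ω), and let z ∈ ∂Ω. Suppose there exists a sequence f_m ∈ A^∞(Ω) such that f_m(z) = 1 (the value at z of the continuous extension of f_m) and ‖f_m‖_{A²(Ω)} → 0 as m → ∞. Then A^∞(Ω) ∩ I(z) is dense in A²(Ω). -/

import Mathlib

open MeasureTheory Complex Topology Filter

noncomputable section

/-- ℂⁿ, identified with ℝ^{2n} carrying Lebesgue measure. -/
abbrev Cn (n : ℕ) := Fin n → ℂ

/-- `g ∈ A^∞(Ω)`: `g` is holomorphic on `Ω` and is the restriction to `Ω` of a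
`C^∞`-smooth function on ℂⁿ. -/
def MemAInfty {n : ℕ} (Ω : Set (Cn n)) (g : Cn n → ℂ) : Prop :=
  DifferentiableOn ℂ g Ω ∧ ∃ F : Cn n → ℂ, ContDiff ℝ (⊤ : ℕ∞) F ∧ Set.EqOn F g Ω

/-- The continuous extension of `g` takes the value `c` at `z`: every continuous function
on ℂⁿ agreeing with `g` on `Ω` takes the value `c` at `z`.  (For `z` in the closure of `Ω`
and `g` admitting a continuous extension, this determines `c` uniquely.) -/
def ExtValue {n : ℕ} (Ω : Set (Cn n)) (g : Cn n → ℂ) (z : Cn n) (c : ℂ) : Prop :=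
  ∀ F : Cn n → ℂ, Continuous F → Set.EqOn F g Ω → F z = c

/-- `g ∈ A²(Ω)`: `g` is holomorphic on `Ω` and square-integrable on `Ω`. -/
def MemA2 {n : ℕ} (Ω : Set (Cn n)) (g : Cn n → ℂ) : Prop :=
  DifferentiableOn ℂ g Ω ∧ IntegrableOn (fun z => ‖g z‖ ^ 2) Ω volume

lemma MemAInfty.integrableOn_sq {n : ℕ} {Ω : Set (Cn n)} (hΩopen : IsOpen Ω)
    (hΩbdd : Bornology.IsBounded Ω) {h : Cn n → ℂ} (hh : MemAInfty Ω h) :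
    IntegrableOn (fun z => ‖h z‖ ^ 2) Ω volume := by
  obtain ⟨-, F, hF, hFe⟩ := hh
  have hc : Continuous (fun w => ‖F w‖ ^ 2) := (hF.continuous.norm).pow 2
  have h1 : IntegrableOn (fun w => ‖F w‖ ^ 2) Ω volume :=
    (hc.continuousOn.integrableOn_compact hΩbdd.isCompact_closure).mono_set subset_closure
  refine h1.congr_fun (fun w hw => ?_) hΩopen.measurableSet
  simp only [hFe hw]

lemma normsq_sub_le (a b : ℂ) : ‖a - b‖ ^ 2 ≤ 2 * ‖a‖ ^ 2 + 2 * ‖b‖ ^ 2 := by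
  have h1 := norm_sub_le a b
  have h2 : ‖a - b‖ ^ 2 ≤ (‖a‖ + ‖b‖) ^ 2 := by gcongr
  nlinarith [sq_nonneg (‖a‖ - ‖b‖)]

/-- If `A^∞(Ω)` is dense in `A²(Ω)` and there is a sequence
`f_m ∈ A^∞(Ω)` with `f_m(z) = 1` (boundary value of the continuous extension) and
`‖f_m‖_{A²} → 0`, then `A^∞(Ω) ∩ I(z)` is dense in `A²(Ω)`. -/
theorem statement3 {n : ℕ} (Ω : Set (Cn n)) (hΩopen : IsOpen Ω)
    (hΩbdd : Bornology.IsBounded Ω)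
    (hdense : ∀ g : Cn n → ℂ, MemA2 Ω g → ∀ ε : ℝ, 0 < ε →
      ∃ h : Cn n → ℂ, MemAInfty Ω h ∧ ∫ w in Ω, ‖g w - h w‖ ^ 2 < ε)
    (z : Cn n) (hz : z ∈ frontier Ω)
    (f : ℕ → (Cn n → ℂ)) (hf : ∀ m, MemAInfty Ω (f m))
    (hfz : ∀ m, ExtValue Ω (f m) z 1)
    (hfnorm : Filter.Tendsto (fun m => ∫ w in Ω, ‖f m w‖ ^ 2) Filter.atTop (𝓝 0)) :
    ∀ g : Cn n → ℂ, MemA2 Ω g → ∀ ε : ℝ, 0 < ε →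
      ∃ h : Cn n → ℂ, MemAInfty Ω h ∧ ExtValue Ω h z 0 ∧
        ∫ w in Ω, ‖g w - h w‖ ^ 2 < ε := by
  intro g hg ε hε
  obtain ⟨h0, hh0, hlt⟩ := hdense g hg (ε / 4) (by linarith)
  have hi0 := hh0.integrableOn_sq hΩopen hΩbdd
  obtain ⟨hd0, H, hH, hHe⟩ := id hh0
  have hev : ∀ᶠ m in atTop, ‖H z‖ ^ 2 * ∫ w in Ω, ‖f m w‖ ^ 2 < ε / 4 := by
    have ht := hfnorm.const_mul (‖H z‖ ^ 2)
    rw [mul_zero] at ht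
    exact ht.eventually (gt_mem_nhds (by linarith))
  obtain ⟨m, hm⟩ := hev.exists
  have him := (hf m).integrableOn_sq hΩopen hΩbdd
  obtain ⟨hdm, Fm, hFm, hFme⟩ := hf m
  have hFmz : Fm z = 1 := hfz m Fm hFm.continuous hFme
  have hsub : IntegrableOn (fun w => ‖g w - h0 w‖ ^ 2) Ω volume := by
    refine Integrable.mono' ((hg.2.const_mul 2).add (hi0.const_mul 2)) ?_ ?_
    · exact ((hg.1.sub hd0).continuousOn.norm.pow 2).aestronglyMeasurable
        hΩopen.measurableSet
    · refine Eventually.of_forall fun w => ?_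
      rw [Real.norm_of_nonneg (by positivity)]
      exact normsq_sub_le _ _
  refine ⟨fun w => h0 w - H z * f m w, ⟨hd0.sub (hdm.const_mul _),
    fun w => H w - H z * Fm w, hH.sub (contDiff_const.mul hFm), fun w hw => ?_⟩, ?_, ?_⟩
  · simp only [hHe hw, hFme hw]
  · intro F hF hFe
    have hEq : Set.EqOn F (fun w => H w - H z * Fm w) (closure Ω) := by
      refine Set.EqOn.closure (fun w hw => ?_) hF
        (hH.continuous.sub (continuous_const.mul hFm.continuous))
      simp only [hFe hw, hHe hw, hFme hw]
    rw [hEq (frontier_subset_closure hz)]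
    simp [hFmz]
  · have hle : ∫ w in Ω, ‖g w - (h0 w - H z * f m w)‖ ^ 2 ≤
        ∫ w in Ω, (2 * ‖g w - h0 w‖ ^ 2 + 2 * ‖H z‖ ^ 2 * ‖f m w‖ ^ 2) := by
      refine integral_mono_of_nonneg (Eventually.of_forall fun w => by positivity)
        ((hsub.const_mul 2).add (him.const_mul _)) (Eventually.of_forall fun w => ?_)
      have h1 := normsq_sub_le (g w - h0 w) (-(H z * f m w))
      rw [norm_neg, norm_mul, mul_pow] at h1
      have h2 : g w - (h0 w - H z * f m w) = g w - h0 w - -(H z * f m w) := by ring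
      simp only [h2]
      linarith
    rw [integral_add (hsub.const_mul 2) (him.const_mul _), integral_const_mul,
      integral_const_mul] at hle
    linarith
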